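/- Large deviation lower bound for the degree distribution of the classical Erdős–Rényi graph with a fixed number of edges: Fix c > 0 and for each n let G(n, ⌊nc/2⌋) denote the uniform distribution on the set of simple graphs on n vertices with exactly ⌊nc/2⌋ edges. Then for every subset Γ of the space of probability measures on ℕ (weak topology), liminf_{n→∞} (1/n) · log G(n, ⌊nc/2⌋){ z : D_z ∈ Γ } ≥ − inf_{p ∈ int(Γ)} I_c(p), where int(Γ) denotes the interior of Γ. -/

import Mathlib

open Filter
open scoped ENNReal BigOperators Classical

/-- The degree distribution `D_z` of a simple graph `z` on `n` vertices:
`D_z(k) = (1/n) · #{vertices i with degree k}`. -/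
noncomputable def degreeDist {n : ℕ} (z : SimpleGraph (Fin n)) (k : ℕ) : ℝ :=
  (Nat.card {i : Fin n // Nat.card {j : Fin n // z.Adj i j} = k} : ℝ) / n

/-- `erProb n m A` is the probability of the event `A` under the uniform
distribution `G(n, m)` on the set of simple graphs on `n` vertices with
exactly `m` edges. -/
noncomputable def erProb (n m : ℕ) (A : Set (SimpleGraph (Fin n))) : ℝ≥0∞ :=
  (Nat.card {z : SimpleGraph (Fin n) // Nat.card z.edgeSet = m ∧ z ∈ A} : ℝ≥0∞) /
  (Nat.card {z : SimpleGraph (Fin n) // Nat.card z.edgeSet = m} : ℝ≥0∞)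

/-- `p` is a probability mass function: nonnegative with total mass one. -/
def IsPMF {X : Type*} (p : X → ℝ) : Prop := (∀ x, 0 ≤ p x) ∧ HasSum p 1

/-- Relative entropy `H(p ∥ q) = Σ_x p(x) log (p(x)/q(x)) ∈ [0,∞]` of probability
mass functions.  Since each term `p log (p/q) - p + q` is nonnegative and
`Σ (p - q) = 0`, this agrees with the usual definition; if `p` is not absolutely
continuous with respect to `q`, the relative entropy is `∞`. -/
noncomputable def relEntropy {X : Type*} (p q : X → ℝ) : ℝ≥0∞ :=
  if ∀ x, q x = 0 → p x = 0 then
    ∑' x, ENNReal.ofReal (p x * Real.log (p x / q x) - p x + q x)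
  else ∞

/-- The Poisson distribution on `ℕ` with mean `c`: `q_c(k) = e^{-c} c^k / k!`. -/
noncomputable def poissonPMF (c : ℝ) (k : ℕ) : ℝ :=
  Real.exp (-c) * c ^ k / (k.factorial : ℝ)

/-- The rate function `I_c(p) = H(p ∥ q_c)` if `p` is a probability measure on `ℕ`
with mean `c`, and `∞` otherwise. -/
noncomputable def rateI (c : ℝ) (p : ℕ → ℝ) : ℝ≥0∞ :=
  if IsPMF p ∧ HasSum (fun k : ℕ => (k : ℝ) * p k) c then
    relEntropy p (poissonPMF c)
  else ∞


/-- degree in an edge finset -/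
noncomputable def ldpDeg {n : ℕ} (F : Finset (Sym2 (Fin n))) (i : Fin n) : ℕ :=
  (F.filter (fun e => i ∈ e)).card

noncomputable def ldpE (n : ℕ) : Finset (Sym2 (Fin n)) :=
  Finset.univ.filter (fun e => ¬ e.IsDiag)

lemma ldpE_card (n : ℕ) : (ldpE n).card = n.choose 2 := by
  have := Sym2.card_subtype_not_diag (α := Fin n)
  rw [Fintype.card_subtype, Fintype.card_fin] at this
  unfold ldpE
  convert this

lemma ldpDeg_sum {n m : ℕ} (F : Finset (Sym2 (Fin n))) (hF : F ∈ (ldpE n).powersetCard m) :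
    ∑ i, ldpDeg F i = 2 * m := by
  rw [Finset.mem_powersetCard] at hF
  obtain ⟨h1, h2⟩ := hF
  have : ∑ i, ldpDeg F i = ∑ e ∈ F, (Finset.univ.filter (fun i : Fin n => i ∈ e)).card := by
    simp only [ldpDeg, Finset.card_filter]
    rw [Finset.sum_comm]
  rw [this, Finset.sum_const_nat (m := 2), h2, mul_comm]
  intro e he
  have h3 := h1 he
  simp only [ldpE, Finset.mem_filter, Finset.mem_univ, true_and] at h3
  rw [← Sym2.card_toFinset_of_not_isDiag e h3]
  congr 1
  ext i; simp

lemma ldpDeg_insert {n : ℕ} (F : Finset (Sym2 (Fin n))) (e : Sym2 (Fin n)) (he : e ∉ F) (i : Fin n) :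
    ldpDeg (insert e F) i = ldpDeg F i + if i ∈ e then 1 else 0 := by
  unfold ldpDeg
  rw [Finset.filter_insert]
  split_ifs
  · rw [Finset.card_insert_of_notMem]; simp [he]
  · simp

/-- weight -/
noncomputable def ldpW {n : ℕ} (d : Fin n → ℕ) (F : Finset (Sym2 (Fin n))) : ℕ :=
  ∏ i, (d i).descFactorial (ldpDeg F i)

lemma ldpW_insert {n : ℕ} (d : Fin n → ℕ) (F : Finset (Sym2 (Fin n))) (a b : Fin n) (hab : a ≠ b)
    (he : s(a,b) ∉ F) :
    ldpW d (insert s(a,b) F) = ldpW d F * ((d a - ldpDeg F a) * (d b - ldpDeg F b)) := by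
  unfold ldpW
  have : ∀ i, (d i).descFactorial (ldpDeg (insert s(a,b) F) i) = (d i).descFactorial (ldpDeg F i) *
     ((if i = a then (d a - ldpDeg F a) else 1) * (if i = b then (d b - ldpDeg F b) else 1)) := by
    intro i
    rw [ldpDeg_insert _ _ he]
    by_cases h1 : i = a
    · subst h1
      simp [hab, Nat.descFactorial_succ, mul_comm]
    · by_cases h2 : i = b
      · subst h2
        simp [h1, Nat.descFactorial_succ, mul_comm]
      · simp [h1, h2]
  simp_rw [this, Finset.prod_mul_distrib]
  simp

lemma ldp_sum_insert {n m : ℕ} (w : Finset (Sym2 (Fin n)) → ℕ) :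
    (m+1) * ∑ F ∈ (ldpE n).powersetCard (m+1), w F
      = ∑ F ∈ (ldpE n).powersetCard m, ∑ e ∈ ldpE n \ F, w (insert e F) := by
  have h : (m+1) * ∑ F ∈ (ldpE n).powersetCard (m+1), w F
     = ∑ F ∈ (ldpE n).powersetCard (m+1), ∑ e ∈ F, w F := by
    rw [Finset.mul_sum]
    apply Finset.sum_congr rfl
    intro F hF
    rw [Finset.sum_const, (Finset.mem_powersetCard.1 hF).2]; simp
  rw [h, Finset.sum_sigma', Finset.sum_sigma']
  refine Finset.sum_bij' (fun x _ => ⟨x.1.erase x.2, x.2⟩) (fun x _ => ⟨insert x.2 x.1, x.2⟩) ?_ ?_ ?_ ?_ ?_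
  · rintro ⟨F, e⟩ h
    simp only [Finset.mem_sigma, Finset.mem_powersetCard, Finset.mem_sdiff] at h ⊢
    refine ⟨⟨(Finset.erase_subset _ _).trans h.1.1, ?_⟩, h.1.1 h.2, by simp⟩
    rw [Finset.card_erase_of_mem h.2, h.1.2]; simp
  · rintro ⟨F, e⟩ h
    simp only [Finset.mem_sigma, Finset.mem_powersetCard, Finset.mem_sdiff] at h ⊢
    refine ⟨⟨Finset.insert_subset h.2.1 h.1.1, ?_⟩, by simp⟩
    rw [Finset.card_insert_of_notMem h.2.2, h.1.2]
  · rintro ⟨F, e⟩ h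
    simp only [Finset.mem_sigma] at h
    simp [Finset.insert_erase h.2]
  · rintro ⟨F, e⟩ h
    simp only [Finset.mem_sigma, Finset.mem_sdiff] at h
    simp [Finset.erase_insert h.2.2]
  · rintro ⟨F, e⟩ h
    simp only [Finset.mem_sigma] at h
    simp [Finset.insert_erase h.2]

lemma ldp_pairs {n : ℕ} (A : Finset (Sym2 (Fin n))) (f : Sym2 (Fin n) → ℕ) :
    ∑ x ∈ (Finset.univ : Finset (Fin n × Fin n)).filter (fun x => s(x.1,x.2) ∈ A), f s(x.1,x.2)
      ≤ 2 * ∑ e ∈ A, f e := by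
  rw [← Finset.sum_fiberwise_of_maps_to (t := A) (g := fun x : Fin n × Fin n => s(x.1,x.2)), Finset.mul_sum]
  · apply Finset.sum_le_sum
    intro e he
    rw [Finset.sum_congr rfl (g := fun _ => f e)]
    · rw [Finset.sum_const, smul_eq_mul]
      apply Nat.mul_le_mul_right
      induction e using Sym2.ind with
      | _ a b =>
        refine (Finset.card_le_card (t := {(a,b),(b,a)}) ?_).trans Finset.card_le_two
        rintro ⟨x, y⟩ h
        simp only [Finset.mem_filter, Sym2.eq_iff] at h
        simp
        tauto
    · intro x hx
      simp only [Finset.mem_filter] at hx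
      rw [hx.2]
  · intro x hx
    simpa using hx

lemma ldp_step {n m Δ : ℕ} (d : Fin n → ℕ) (hd : ∀ i, d i ≤ Δ) (F : Finset (Sym2 (Fin n)))
    (hF : F ∈ (ldpE n).powersetCard m) :
    ldpW d F * ((∑ i, d i - 2 * m) * (∑ i, d i - 2 * m - Δ^2)) ≤
      2 * ∑ e ∈ ldpE n \ F, ldpW d (insert e F) := by
  refine le_trans ?_ (ldp_pairs _ _)
  set r : Fin n → ℕ := fun i => d i - ldpDeg F i with hr
  have hR : ∑ i, d i - 2 * m ≤ ∑ i, r i := by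
    rw [← ldpDeg_sum F hF, tsub_le_iff_right, ← Finset.sum_add_distrib]
    apply Finset.sum_le_sum; intro i _; simp only [hr]; omega
  have h1 : ∀ x ∈ (Finset.univ : Finset (Fin n × Fin n)).filter (fun x => s(x.1,x.2) ∈ ldpE n \ F),
      ldpW d (insert s(x.1,x.2) F) = ldpW d F * (r x.1 * r x.2) := by
    rintro ⟨a, b⟩ h
    simp only [Finset.mem_filter, Finset.mem_sdiff, ldpE, Finset.mem_univ, true_and, Sym2.mk_isDiag_iff] at h
    exact ldpW_insert d F a b h.1 h.2
  rw [Finset.sum_congr rfl h1, ← Finset.mul_sum]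
  apply Nat.mul_le_mul_left
  rw [Finset.sum_filter, Fintype.sum_prod_type]
  calc _ ≤ (∑ i, r i) * (∑ i, d i - 2 * m - Δ^2) := Nat.mul_le_mul_right _ hR
    _ = ∑ a, r a * (∑ i, d i - 2 * m - Δ^2) := Finset.sum_mul _ _ _
    _ ≤ _ := by
      apply Finset.sum_le_sum
      intro a _
      rcases Nat.eq_zero_or_pos (r a) with h0 | h0
      · simp [h0]
      have hdeg : ldpDeg F a < Δ := by
        have := hd a; simp only [hr] at h0; omega
      set bad : Finset (Fin n) := insert a (Finset.univ.filter (fun b => s(a,b) ∈ F)) with hbad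
      have hbc : bad.card ≤ Δ := by
        refine (Finset.card_insert_le _ _).trans ?_
        have : (Finset.univ.filter (fun b => s(a,b) ∈ F)).card ≤ ldpDeg F a := by
          apply Finset.card_le_card_of_injOn (fun b => s(a,b))
          · intro b hb
            simpa using hb
          · intro b _ b' _ h
            exact Sym2.congr_right.1 h
        omega
      have hbs : ∑ b ∈ bad, r b ≤ Δ^2 := by
        calc _ ≤ bad.card • Δ := Finset.sum_le_card_nsmul _ _ _ (fun i _ => by simp only [hr]; have := hd i; omega)
          _ ≤ _ := by rw [smul_eq_mul, sq]; exact Nat.mul_le_mul_right _ hbc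
      have hsplit : ∑ i, r i = ∑ b ∈ bad, r b + ∑ b ∈ badᶜ, r b := (Finset.sum_add_sum_compl bad r).symm
      calc _ ≤ r a * ∑ b ∈ badᶜ, r b := by apply Nat.mul_le_mul_left; omega
        _ = ∑ b ∈ badᶜ, r a * r b := Finset.mul_sum _ _ _
        _ = ∑ b, if b ∈ badᶜ then r a * r b else 0 := by rw [Finset.sum_ite_mem, Finset.univ_inter]
        _ ≤ _ := by
          apply Finset.sum_le_sum
          intro b _
          split_ifs with h1 h2
          · exact le_rfl
          · exfalso; apply h2
            simp only [hbad, Finset.mem_compl, Finset.mem_insert, Finset.mem_filter, Finset.mem_univ, true_and, not_or] at h1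
            simp only [Finset.mem_sdiff, ldpE, Finset.mem_filter, Finset.mem_univ, true_and, Sym2.mk_isDiag_iff]
            exact ⟨fun h => h1.1 h.symm, h1.2⟩
          · exact Nat.zero_le _
          · exact le_rfl

lemma ldp_greedy {n Δ : ℕ} (d : Fin n → ℕ) (hd : ∀ i, d i ≤ Δ) (m : ℕ) :
    (∑ i, d i - Δ^2).descFactorial (2*m) ≤ 2^m * m.factorial * ∑ F ∈ (ldpE n).powersetCard m, ldpW d F := by
  induction m with
  | zero => simp [ldpW, ldpDeg]
  | succ m ih =>
    have h1 : (∑ F ∈ (ldpE n).powersetCard m, ldpW d F) * ((∑ i, d i - 2 * m) * (∑ i, d i - 2 * m - Δ^2))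
       ≤ 2 * ((m+1) * ∑ F ∈ (ldpE n).powersetCard (m+1), ldpW d F) := by
      rw [ldp_sum_insert, Finset.sum_mul, Finset.mul_sum]
      exact Finset.sum_le_sum fun F hF => ldp_step d hd F hF
    set S := ∑ i, d i
    have h2 : (S - Δ^2 - (2*m+1)) * (S - Δ^2 - 2*m) ≤ (S - 2*m) * (S - 2*m - Δ^2) :=
      Nat.mul_le_mul (by omega) (by omega)
    rw [show 2 * (m+1) = 2*m+1+1 by ring, Nat.descFactorial_succ, Nat.descFactorial_succ, ← mul_assoc]
    calc _ ≤ ((S - 2*m) * (S - 2*m - Δ^2)) * (2^m * m.factorial * ∑ F ∈ (ldpE n).powersetCard m, ldpW d F) :=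
          Nat.mul_le_mul h2 ih
      _ = 2^m * m.factorial * ((∑ F ∈ (ldpE n).powersetCard m, ldpW d F) * ((S - 2 * m) * (S - 2 * m - Δ^2))) := by ring
      _ ≤ 2^m * m.factorial * (2 * ((m+1) * ∑ F ∈ (ldpE n).powersetCard (m+1), ldpW d F)) := Nat.mul_le_mul_left _ h1
      _ = _ := by rw [Nat.factorial_succ]; ring


lemma ldp_lym {α : Type*} (E : Finset α) {k m : ℕ} (hkm : k ≤ m) (hm : m ≤ E.card)
    (A G : Finset (Finset α)) (hA : A ⊆ E.powersetCard k) (hG : G ⊆ E.powersetCard m)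
    (h : ∀ F ∈ A, ∀ F' ∈ E.powersetCard m, F ⊆ F' → F' ∈ G) :
    A.card * E.card.choose m ≤ G.card * E.card.choose k := by
  have h1 : A.card * (E.card - k).choose (m - k) ≤ G.card * m.choose k := by
    apply Finset.card_mul_le_card_mul (fun F F' => F ⊆ F')
    · intro F hF
      have hF' := Finset.mem_powersetCard.1 (hA hF)
      rw [← hF'.2, ← Finset.card_sdiff_of_subset hF'.1, ← Finset.card_powersetCard]
      apply Finset.card_le_card_of_injOn (fun X => F ∪ X)
      · intro X hX
        have hX' := Finset.mem_powersetCard.1 hX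
        simp only [Finset.coe_filter, Set.mem_ofPred_eq, Finset.bipartiteAbove]
        refine ⟨h F hF _ (Finset.mem_powersetCard.2 ⟨Finset.union_subset hF'.1 (hX'.1.trans Finset.sdiff_subset), ?_⟩) Finset.subset_union_left, Finset.subset_union_left⟩
        rw [Finset.card_union_of_disjoint, hX'.2]
        · omega
        · exact (Finset.disjoint_of_subset_left hX'.1 Finset.sdiff_disjoint).symm
      · intro X hX Y hY hXY
        have hX' := Finset.mem_powersetCard.1 hX
        have hY' := Finset.mem_powersetCard.1 hY
        have e1 : Disjoint F X := (Finset.disjoint_of_subset_left hX'.1 Finset.sdiff_disjoint).symm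
        have e2 : Disjoint F Y := (Finset.disjoint_of_subset_left hY'.1 Finset.sdiff_disjoint).symm
        have := congrArg (fun Z => Z \ F) hXY
        simpa [Finset.union_sdiff_cancel_left e1, Finset.union_sdiff_cancel_left e2] using this
    · intro F hF
      have hF' := Finset.mem_powersetCard.1 (hG hF)
      rw [← hF'.2, ← Finset.card_powersetCard]
      apply Finset.card_le_card
      intro X hX
      simp only [Finset.bipartiteBelow, Finset.mem_filter] at hX
      exact Finset.mem_powersetCard.2 ⟨hX.2, (Finset.mem_powersetCard.1 (hA hX.1)).2⟩
  have h2 := Nat.choose_mul (n := E.card) (k := m) (s := k) hkm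
  have h3 : 0 < m.choose k := Nat.choose_pos hkm
  apply Nat.le_of_mul_le_mul_right _ h3
  rw [mul_assoc, h2]
  calc _ = (A.card * (E.card - k).choose (m - k)) * E.card.choose k := by ring
    _ ≤ (G.card * m.choose k) * E.card.choose k := Nat.mul_le_mul_right _ h1
    _ = _ := by ring

lemma ldp_count {n L : ℕ} (D : Fin n → ℕ) (S r : ℕ) (hr : S = ∑ i, D i + r) (x : ℝ) (hx0 : 0 < x) (hx1 : x < 1)
   (T : Finset (Fin n → Fin (L+1))) (hT : ∀ d ∈ T, (∀ i, D i ≤ d i) ∧ ∑ i, (d i : ℕ) = S) :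
   (T.card : ℝ) * (x^r * (1-x)^n) ≤ 1 := by
  have h1 : (T.card : ℝ) * x^r ≤ (∑ j : Fin (L+1), x^(j:ℕ))^n := by
    have : (∑ j : Fin (L+1), x^(j:ℕ))^n = ∑ d : Fin n → Fin (L+1), ∏ i, x^(d i : ℕ) := by
      have := Fintype.sum_pow (fun j : Fin (L+1) => x^(j:ℕ)) n
      rw [this]
    rw [this]
    set sub : (Fin n → Fin (L+1)) → (Fin n → Fin (L+1)) :=
      fun d i => ⟨(d i : ℕ) - D i, by have := (d i).2; omega⟩ with hsub
    have hinj : Set.InjOn sub T := by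
      intro d hd d' hd' h
      ext i
      have := congrArg (fun f => (f i : ℕ)) h
      simp only [hsub] at this
      have h1 := (hT d hd).1 i
      have h2 := (hT d' hd').1 i
      omega
    calc (T.card : ℝ) * x^r = ∑ d ∈ T, ∏ i, x^(sub d i : ℕ) := by
          rw [← nsmul_eq_mul]
          symm
          apply Finset.sum_eq_card_nsmul
          intro d hd
          rw [Finset.prod_pow_eq_pow_sum]
          congr 1
          have h2 := (hT d hd).2
          have h3 : ∑ i, (d i : ℕ) = ∑ i, D i + ∑ i, (sub d i : ℕ) := by
            rw [← Finset.sum_add_distrib]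
            apply Finset.sum_congr rfl
            intro i _
            have h1 := (hT d hd).1 i
            simp only [hsub]; omega
          omega
      _ = ∑ e ∈ T.image sub, ∏ i, x^(e i : ℕ) := by rw [Finset.sum_image hinj]
      _ ≤ _ := Finset.sum_le_univ_sum_of_nonneg (fun e => by positivity)
  have h2 : (∑ j : Fin (L+1), x^(j:ℕ)) * (1 - x) ≤ 1 := by
    rw [Fin.sum_univ_eq_sum_range (fun j => x^j), geom_sum_mul_neg]
    have : 0 < x^(L+1) := by positivity
    linarith
  have hx : 0 ≤ 1 - x := by linarith
  calc _ = (T.card : ℝ) * x^r * (1-x)^n := by ring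
    _ ≤ (∑ j : Fin (L+1), x^(j:ℕ))^n * (1-x)^n := by gcongr
    _ = ((∑ j : Fin (L+1), x^(j:ℕ)) * (1 - x))^n := by rw [mul_pow]
    _ ≤ 1 := pow_le_one₀ (by positivity) h2

lemma ldp_fiber {n L : ℕ} (d : Fin n → Fin (L+1)) (P : Finset (Equiv.Perm (Fin n))) :
    P.card ≤ (∏ k, ((Finset.univ.filter (fun i => d i = k)).card).factorial) * (P.image (fun σ : Equiv.Perm (Fin n) => d ∘ σ)).card := by
  have h0 : Fintype.card {g : Equiv.Perm (Fin n) // d ∘ g = d} =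
      ∏ k, ((Finset.univ.filter (fun i => d i = k)).card).factorial := by
    have := DomMulAct.stabilizer_card d
    simp only [Fintype.card_subtype] at this ⊢
    convert this
  apply Finset.card_le_mul_card_image
  intro f hf
  obtain ⟨τ, hτ, rfl⟩ := Finset.mem_image.1 hf
  rw [← h0, Fintype.card_subtype]
  apply Finset.card_le_card_of_injOn (fun σ => σ * τ⁻¹)
  · intro σ hσ
    simp only [Finset.coe_filter, Set.mem_ofPred_eq] at hσ
    simp only [Finset.coe_filter, Set.mem_ofPred_eq, Finset.mem_univ, true_and]
    funext i
    have := congrFun hσ.2 (τ⁻¹ i)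
    simpa using this
  · intro σ _ σ' _ h
    simpa using h

lemma ldp_main_count {n L m m' r : ℕ} (d : Fin n → Fin (L+1)) (x : ℝ) (hx0 : 0 < x) (hx1 : x < 1)
    (hmm : m' ≤ m) (hm : m ≤ n.choose 2) (hr : ∑ i, (d i : ℕ) = 2 * m' + r) (hrL : L^2 ≤ r)
    (G : Finset (Finset (Sym2 (Fin n)))) (hG : G ⊆ (ldpE n).powersetCard m)
    (hG2 : ∀ F ∈ (ldpE n).powersetCard m, ∀ F' ∈ (ldpE n).powersetCard m', F' ⊆ F →
      (∃ σ : Equiv.Perm (Fin n), ∀ i, ldpDeg F' i ≤ d (σ i)) → F ∈ G) :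
    (n.factorial : ℝ) * (2 * m' + r - L^2).factorial * (x^r * (1-x)^n) * (n.choose 2).choose m ≤
      G.card * ((n : ℝ)^(2*m') * (r - L^2).factorial * (∏ i, ((d i : ℕ).factorial : ℝ)) *
       (∏ k, (((Finset.univ.filter (fun i => d i = k)).card).factorial : ℝ))) := by
  set A := ((ldpE n).powersetCard m').filter (fun F => ∃ σ : Equiv.Perm (Fin n), ∀ i, ldpDeg F i ≤ d (σ i)) with hA
  have hlym : A.card * (n.choose 2).choose m ≤ G.card * (n.choose 2).choose m' := by
    rw [← ldpE_card]
    apply ldp_lym _ hmm (by rw [ldpE_card]; exact hm) A G (Finset.filter_subset _ _) hG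
    intro F hF F' hF' hs
    rw [hA, Finset.mem_filter] at hF
    exact hG2 F' hF' F hF.1 hs hF.2
  have hcho : 2^m' * m'.factorial * (n.choose 2).choose m' ≤ n^(2*m') := by
    rw [mul_assoc, ← Nat.descFactorial_eq_factorial_mul_choose]
    calc _ ≤ 2^m' * (n.choose 2)^m' := Nat.mul_le_mul_left _ (Nat.descFactorial_le_pow _ _)
      _ = (2 * n.choose 2)^m' := by rw [mul_pow]
      _ ≤ (n^2)^m' := by
        apply Nat.pow_le_pow_left
        rw [Nat.choose_two_right, sq]
        calc _ ≤ n * (n-1) := Nat.mul_div_le _ _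
          _ ≤ _ := Nat.mul_le_mul_left _ (Nat.sub_le _ _)
      _ = _ := by rw [← pow_mul]
  set Q : ℕ := ∏ k, ((Finset.univ.filter (fun i => d i = k)).card).factorial with hQ
  set W : ℕ := ∏ i, (d i : ℕ).factorial with hW
  -- sum over permutations
  have hsum : n.factorial * (2 * m' + r - L^2).descFactorial (2*m') ≤
      2^m' * m'.factorial * ∑ F ∈ A, (Finset.univ.filter (fun σ : Equiv.Perm (Fin n) => ∀ i, ldpDeg F i ≤ d (σ i))).card * W := by
    have e1 : ∀ σ : Equiv.Perm (Fin n), (2 * m' + r - L^2).descFactorial (2*m') ≤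
        2^m' * m'.factorial * ∑ F ∈ (ldpE n).powersetCard m', ldpW (fun i => (d (σ i) : ℕ)) F := by
      intro σ
      have := ldp_greedy (Δ := L) (fun i => (d (σ i) : ℕ)) (fun i => Nat.lt_succ_iff.1 (d (σ i)).2) m'
      rwa [Equiv.sum_comp σ (fun i => (d i : ℕ)), hr] at this
    calc _ = ∑ σ : Equiv.Perm (Fin n), (2 * m' + r - L^2).descFactorial (2*m') := by
          rw [Finset.sum_const, Finset.card_univ, Fintype.card_perm, Fintype.card_fin, smul_eq_mul]
      _ ≤ ∑ σ : Equiv.Perm (Fin n), 2^m' * m'.factorial * ∑ F ∈ (ldpE n).powersetCard m', ldpW (fun i => (d (σ i) : ℕ)) F :=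
          by apply Finset.sum_le_sum; intro σ _; exact e1 σ
      _ = 2^m' * m'.factorial * ∑ F ∈ (ldpE n).powersetCard m', ∑ σ : Equiv.Perm (Fin n), ldpW (fun i => (d (σ i) : ℕ)) F := by
          rw [← Finset.mul_sum, Finset.sum_comm]
      _ ≤ _ := by
        apply Nat.mul_le_mul_left
        rw [hA, Finset.sum_filter]
        apply Finset.sum_le_sum
        intro F hF
        have e2 : ∀ σ : Equiv.Perm (Fin n), ldpW (fun i => (d (σ i) : ℕ)) F ≤ if (∀ i, ldpDeg F i ≤ d (σ i)) then W else 0 := by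
          intro σ
          split_ifs with h
          · rw [hW, ← Equiv.prod_comp σ]
            apply Finset.prod_le_prod' 
            intro i _
            rcases le_or_gt (ldpDeg F i) (d (σ i)) with h1 | h1
            · rw [← Nat.factorial_mul_descFactorial h1]
              exact Nat.le_mul_of_pos_left _ (Nat.factorial_pos _)
            · rw [Nat.descFactorial_eq_zero_iff_lt.2 h1]; exact Nat.zero_le _
          · push Not at h
            obtain ⟨i, hi⟩ := h
            rw [ldpW, Finset.prod_eq_zero (Finset.mem_univ i)]
            exact Nat.descFactorial_eq_zero_iff_lt.2 hi
        have e3 : ∑ σ : Equiv.Perm (Fin n), ldpW (fun i => (d (σ i) : ℕ)) F ≤ ∑ σ : Equiv.Perm (Fin n), if (∀ i, ldpDeg F i ≤ d (σ i)) then W else 0 := by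
          apply Finset.sum_le_sum; intro σ _; exact e2 σ
        rw [← Finset.sum_filter, Finset.sum_const, smul_eq_mul] at e3
        split_ifs with h
        · exact e3
        · refine e3.trans ?_
          push Not at h
          rw [Finset.filter_false_of_mem]
          · simp
          · intro σ _
            push Not
            exact h σ
  have hcard : ∀ F ∈ A, ((Finset.univ.filter (fun σ : Equiv.Perm (Fin n) => ∀ i, ldpDeg F i ≤ d (σ i))).card : ℝ) * (x^r * (1-x)^n) ≤ Q := by
    intro F hF
    rw [hA, Finset.mem_filter] at hF
    set P := (Finset.univ.filter (fun σ : Equiv.Perm (Fin n) => ∀ i, ldpDeg F i ≤ d (σ i))) with hP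
    have e1 : (P.card : ℝ) ≤ Q * (P.image (fun σ : Equiv.Perm (Fin n) => d ∘ σ)).card := by exact_mod_cast ldp_fiber d P
    have e2 := ldp_count (L := L) (ldpDeg F) (2 * m' + r) r (by rw [ldpDeg_sum F hF.1]) x hx0 hx1 (P.image (fun σ : Equiv.Perm (Fin n) => d ∘ σ)) (by
      intro f hf
      obtain ⟨τ, hτ, rfl⟩ := Finset.mem_image.1 hf
      rw [hP, Finset.mem_filter] at hτ
      refine ⟨hτ.2, ?_⟩
      rw [← hr]
      exact Equiv.sum_comp τ (fun i => (d i : ℕ)))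
    have hx : 0 < 1 - x := by linarith
    calc _ ≤ (Q * (P.image (fun σ : Equiv.Perm (Fin n) => d ∘ σ)).card : ℝ) * (x^r * (1-x)^n) := by gcongr
      _ = Q * ((P.image (fun σ : Equiv.Perm (Fin n) => d ∘ σ)).card * (x^r * (1-x)^n)) := by ring
      _ ≤ Q * 1 := by gcongr
      _ = Q := mul_one _
  have hx : 0 < 1 - x := by linarith
  have hfac : (2 * m' + r - L^2).factorial = (r - L^2).factorial * (2 * m' + r - L^2).descFactorial (2*m') := by
    rw [← Nat.factorial_mul_descFactorial (n := 2 * m' + r - L^2) (k := 2 * m') (by omega)]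
    congr 2; omega
  have hsumR : (n.factorial : ℝ) * (2 * m' + r - L^2).descFactorial (2*m') ≤
      2^m' * m'.factorial * ∑ F ∈ A, ((Finset.univ.filter (fun σ : Equiv.Perm (Fin n) => ∀ i, ldpDeg F i ≤ d (σ i))).card : ℝ) * W := by
    exact_mod_cast hsum
  have hlymR : (A.card : ℝ) * (n.choose 2).choose m ≤ G.card * (n.choose 2).choose m' := by exact_mod_cast hlym
  have hchoR : (2:ℝ)^m' * m'.factorial * (n.choose 2).choose m' ≤ (n:ℝ)^(2*m') := by exact_mod_cast hcho
  have hB : (∑ F ∈ A, ((Finset.univ.filter (fun σ : Equiv.Perm (Fin n) => ∀ i, ldpDeg F i ≤ d (σ i))).card : ℝ) * W) * (x^r * (1-x)^n) ≤ A.card * (Q * W) := by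
    rw [Finset.sum_mul, ← nsmul_eq_mul]
    apply Finset.sum_le_card_nsmul
    intro F hF
    calc _ = (((Finset.univ.filter (fun σ : Equiv.Perm (Fin n) => ∀ i, ldpDeg F i ≤ d (σ i))).card : ℝ) * (x^r * (1-x)^n)) * W := by ring
      _ ≤ Q * W := by gcongr; exact hcard F hF
  have eQ : (∏ k, (((Finset.univ.filter (fun i => d i = k)).card).factorial : ℝ)) = (Q : ℝ) := by rw [hQ]; push_cast; rfl
  have eW : (∏ i, ((d i : ℕ).factorial : ℝ)) = (W : ℝ) := by rw [hW]; push_cast; rfl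
  rw [hfac, eQ, eW]
  push_cast
  set R : ℝ := ((r - L^2).factorial : ℝ)
  set Y : ℝ := x^r * (1-x)^n with hY
  have hY0 : 0 < Y := by positivity
  set DD : ℝ := ((2 * m' + r - L^2).descFactorial (2*m') : ℝ)
  set C1 : ℝ := ((n.choose 2).choose m : ℝ)
  set K : ℝ := 2^m' * m'.factorial with hK
  set Z := ∑ F ∈ A, ((Finset.univ.filter (fun σ : Equiv.Perm (Fin n) => ∀ i, ldpDeg F i ≤ d (σ i))).card : ℝ) * W
  calc (n.factorial : ℝ) * (R * DD) * Y * C1 = R * C1 * Y * (n.factorial * DD) := by ring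
    _ ≤ R * C1 * Y * (K * Z) := by gcongr
    _ = R * C1 * K * (Z * Y) := by ring
    _ ≤ R * C1 * K * (A.card * (Q * W)) := by gcongr
    _ = R * K * (Q * W) * (A.card * C1) := by ring
    _ ≤ R * K * (Q * W) * (G.card * (n.choose 2).choose m') := by gcongr
    _ = R * (Q * W) * G.card * (K * (n.choose 2).choose m') := by ring
    _ ≤ R * (Q * W) * G.card * (n:ℝ)^(2*m') := by gcongr
    _ = _ := by ring


lemma ldp_edge_card {n m : ℕ} (A : Set (SimpleGraph (Fin n))) :
    Nat.card {z : SimpleGraph (Fin n) // Nat.card z.edgeSet = m ∧ z ∈ A} =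
     (((ldpE n).powersetCard m).filter (fun F : Finset (Sym2 (Fin n)) => SimpleGraph.fromEdgeSet (F : Set (Sym2 (Fin n))) ∈ A)).card := by
  rw [← Fintype.card_coe, ← Nat.card_eq_fintype_card]
  have key : ∀ F : Finset (Sym2 (Fin n)), F ⊆ ldpE n → (SimpleGraph.fromEdgeSet (F : Set (Sym2 (Fin n)))).edgeSet = F := by
    intro F hF
    rw [SimpleGraph.edgeSet_fromEdgeSet]
    ext e
    simp only [Set.mem_sdiff, Finset.mem_coe]
    constructor
    · exact fun h => h.1
    · intro h
      refine ⟨h, ?_⟩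
      have := hF h
      simpa [ldpE] using this
  refine Nat.card_congr ⟨fun z => ⟨z.1.edgeFinset, ?_⟩, fun F => ⟨SimpleGraph.fromEdgeSet (F.1 : Set (Sym2 (Fin n))), ?_⟩, ?_, ?_⟩
  · rw [Finset.mem_filter, Finset.mem_powersetCard]
    refine ⟨⟨?_, ?_⟩, ?_⟩
    · intro e he
      simp only [ldpE, Finset.mem_filter, Finset.mem_univ, true_and]
      exact z.1.not_isDiag_of_mem_edgeFinset he
    · refine Eq.trans ?_ z.2.1
      rw [Nat.card_eq_fintype_card, SimpleGraph.edgeFinset_card]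
    · have := z.2.2
      simpa using this
  · have h := F.2
    rw [Finset.mem_filter, Finset.mem_powersetCard] at h
    refine ⟨?_, h.2⟩
    rw [key _ h.1.1]
    refine Eq.trans ?_ h.1.2
    simp
  · intro z
    ext1
    simp
  · intro F
    have h := F.2
    rw [Finset.mem_filter, Finset.mem_powersetCard] at h
    ext1
    apply Finset.coe_injective
    simp only [SimpleGraph.coe_edgeFinset]
    exact key _ h.1.1

lemma ldp_edge_card' {n m : ℕ} :
    Nat.card {z : SimpleGraph (Fin n) // Nat.card z.edgeSet = m} = (n.choose 2).choose m := by
  have := ldp_edge_card (n := n) (m := m) Set.univ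
  simp only [Set.mem_univ, and_true, Finset.filter_true, Finset.card_powersetCard, ldpE_card] at this
  exact this

lemma ldp_deg {n m : ℕ} (F : Finset (Sym2 (Fin n))) (hF : F ∈ (ldpE n).powersetCard m) (i : Fin n) :
    Nat.card {j : Fin n // (SimpleGraph.fromEdgeSet (F : Set (Sym2 (Fin n)))).Adj i j} = ldpDeg F i := by
  have hF' := (Finset.mem_powersetCard.1 hF).1
  rw [Nat.card_eq_fintype_card, Fintype.card_subtype, ldpDeg]
  apply Finset.card_bij (fun j _ => s(i,j))
  · intro j hj
    simp only [Finset.mem_filter, Finset.mem_univ, true_and, SimpleGraph.fromEdgeSet_adj] at hj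
    simp only [Finset.mem_filter, Sym2.mem_mk_left, and_true]
    exact hj.1
  · intro a _ b _ h
    exact Sym2.congr_right.1 h
  · intro e he
    rw [Finset.mem_filter] at he
    obtain ⟨j, rfl⟩ := he.2
    refine ⟨j, ?_, rfl⟩
    simp only [Finset.mem_filter, Finset.mem_univ, true_and, SimpleGraph.fromEdgeSet_adj]
    refine ⟨he.1, ?_⟩
    have := hF' he.1
    simpa [ldpE] using this

lemma ldp_count_close {n : ℕ} (f g : Fin n → ℕ) (k : ℕ) :
    |((Finset.univ.filter (fun i => f i = k)).card : ℝ) - (Finset.univ.filter (fun i => g i = k)).card|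
      ≤ ∑ i, |(f i : ℝ) - g i| := by
  simp only [Finset.card_filter, Nat.cast_sum, ← Finset.sum_sub_distrib]
  refine (Finset.abs_sum_le_sum_abs _ _).trans (Finset.sum_le_sum fun i _ => ?_)
  by_cases h : f i = g i
  · simp [h]
  · have : (1:ℝ) ≤ |(f i : ℝ) - g i| := by
      have h2 : (1:ℤ) ≤ |(f i : ℤ) - g i| := Int.one_le_abs (by omega)
      exact_mod_cast h2
    refine le_trans ?_ this
    split_ifs <;> simp

lemma ldp_dist {n m m' r L : ℕ} (d : Fin n → Fin (L+1)) (hmm : m' ≤ m) (hr : ∑ i, (d i : ℕ) = 2 * m' + r)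
    (F F' : Finset (Sym2 (Fin n))) (hF : F ∈ (ldpE n).powersetCard m) (hF' : F' ∈ (ldpE n).powersetCard m')
    (hs : F' ⊆ F) (σ : Equiv.Perm (Fin n)) (hσ : ∀ i, ldpDeg F' i ≤ d (σ i)) (k : ℕ) :
    |degreeDist (SimpleGraph.fromEdgeSet (F : Set (Sym2 (Fin n)))) k -
      ((Finset.univ.filter (fun i => (d i : ℕ) = k)).card : ℝ) / n| ≤ (2 * ((m : ℝ) - m') + r) / n := by
  unfold degreeDist
  simp only [ldp_deg F hF]
  rw [Nat.card_eq_fintype_card, Fintype.card_subtype, ← sub_div, abs_div, Nat.abs_cast]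
  apply div_le_div_of_nonneg_right _ (Nat.cast_nonneg _)
  have h1 : (Finset.univ.filter (fun i => (d i : ℕ) = k)).card = (Finset.univ.filter (fun i => (d (σ i) : ℕ) = k)).card := by
    symm
    apply Finset.card_bij (fun i _ => σ i)
    · intro i hi; simpa using hi
    · intro a _ b _ h; exact σ.injective h
    · intro b hb
      exact ⟨σ.symm b, by simpa using hb, by simp⟩
  rw [h1]
  refine (ldp_count_close (ldpDeg F) (fun i => (d (σ i) : ℕ)) k).trans ?_
  have e1 : ∑ i, (ldpDeg F i : ℝ) = 2 * m := by exact_mod_cast ldpDeg_sum F hF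
  have e2 : ∑ i, (ldpDeg F' i : ℝ) = 2 * m' := by exact_mod_cast ldpDeg_sum F' hF'
  have e3 : ∑ i, ((d (σ i) : ℕ) : ℝ) = 2 * m' + r := by
    rw [Equiv.sum_comp σ (fun i => ((d i : ℕ) : ℝ))]; exact_mod_cast hr
  calc _ ≤ ∑ i, (((ldpDeg F i : ℝ) - ldpDeg F' i) + (((d (σ i) : ℕ) : ℝ) - ldpDeg F' i)) := by
        apply Finset.sum_le_sum
        intro i _
        have a1 : (ldpDeg F' i : ℝ) ≤ ldpDeg F i := by
          exact_mod_cast Finset.card_le_card (Finset.filter_subset_filter _ hs)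
        have a2 : (ldpDeg F' i : ℝ) ≤ ((d (σ i) : ℕ) : ℝ) := by exact_mod_cast hσ i
        rw [abs_le]; constructor <;> linarith
    _ = 2 * ((m : ℝ) - m') + r := by
        rw [Finset.sum_add_distrib, Finset.sum_sub_distrib, Finset.sum_sub_distrib, e1, e2, e3]; ring

lemma ldp_prob {n L m m' r : ℕ} (hn : 0 < n) (d : Fin n → Fin (L+1)) (x : ℝ) (hx0 : 0 < x) (hx1 : x < 1)
    (hmm : m' ≤ m) (hm : m ≤ n.choose 2) (hr : ∑ i, (d i : ℕ) = 2 * m' + r) (hrL : L^2 ≤ r)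
    (A : Set (SimpleGraph (Fin n)))
    (hA : ∀ z, (∀ k, |degreeDist z k - ((Finset.univ.filter (fun i => (d i : ℕ) = k)).card : ℝ) / n| ≤
       (2 * ((m : ℝ) - m') + r) / n) → z ∈ A) :
    ENNReal.ofReal ((n.factorial : ℝ) * (2 * m' + r - L^2).factorial * (x^r * (1-x)^n) /
      ((n : ℝ)^(2*m') * (r - L^2).factorial * (∏ i, ((d i : ℕ).factorial : ℝ)) *
       (∏ k, (((Finset.univ.filter (fun i => d i = k)).card).factorial : ℝ)))) ≤ erProb n m A := by
  unfold erProb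
  rw [ldp_edge_card, ldp_edge_card']
  set G := (((ldpE n).powersetCard m).filter (fun F : Finset (Sym2 (Fin n)) => SimpleGraph.fromEdgeSet (F : Set (Sym2 (Fin n))) ∈ A)) with hG
  have h1 := ldp_main_count d x hx0 hx1 hmm hm hr hrL G (Finset.filter_subset _ _) (by
    intro F hF F' hF' hs ⟨σ, hσ⟩
    rw [hG, Finset.mem_filter]
    exact ⟨hF, hA _ fun k => ldp_dist d hmm hr F F' hF hF' hs σ hσ k⟩)
  have hC : (0:ℝ) < (n.choose 2).choose m := by exact_mod_cast Nat.choose_pos hm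
  have hQ : (0:ℝ) < ∏ k, (((Finset.univ.filter (fun i => d i = k)).card).factorial : ℝ) :=
    Finset.prod_pos fun k _ => by positivity
  have hW : (0:ℝ) < ∏ i, ((d i : ℕ).factorial : ℝ) := Finset.prod_pos fun k _ => by positivity
  rw [← ENNReal.ofReal_natCast, ← ENNReal.ofReal_natCast (n := (n.choose 2).choose m), ← ENNReal.ofReal_div_of_pos hC]
  apply ENNReal.ofReal_le_ofReal
  rw [div_le_div_iff₀ (by positivity) hC]
  exact h1


lemma ldp_log_fact_lower (k : ℕ) : (k : ℝ) * Real.log k - k ≤ Real.log k.factorial := by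
  rcases Nat.eq_zero_or_pos k with rfl | hk
  · simp
  have hk' : (0:ℝ) < k := by exact_mod_cast hk
  have h := Real.pow_div_factorial_le_exp (k:ℝ) hk'.le k
  have h2 := Real.log_le_log (by positivity) h
  rw [Real.log_div (by positivity) (by positivity), Real.log_pow, Real.log_exp] at h2
  linarith

lemma ldp_log_fact_upper (k : ℕ) : Real.log k.factorial ≤ (k : ℝ) * Real.log k - k + 1 + Real.log k := by
  rcases Nat.eq_zero_or_pos k with rfl | hk
  · simp
  induction k, hk using Nat.le_induction with
  | base => simp
  | succ k hk ih =>
    have hk' : (0:ℝ) < k := by exact_mod_cast hk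
    rw [Nat.factorial_succ, Nat.cast_mul, Real.log_mul (by positivity) (by positivity)]
    have h1 : Real.log ((k:ℝ)/(k+1)) ≤ (k:ℝ)/(k+1) - 1 := Real.log_le_sub_one_of_pos (by positivity)
    rw [Real.log_div (by positivity) (by positivity)] at h1
    have h2 : ((k:ℝ)+1) * (Real.log k - Real.log (k+1)) ≤ -1 := by
      calc _ ≤ ((k:ℝ)+1) * ((k:ℝ)/(k+1) - 1) := by gcongr
        _ = -1 := by field_simp; ring
    push_cast
    nlinarith

lemma ldp_log_div : Tendsto (fun n : ℕ => Real.log n / n) atTop (nhds 0) := by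
  have := Real.isLittleO_log_id_atTop.tendsto_div_nhds_zero
  exact this.comp tendsto_natCast_atTop_atTop

lemma ldp_stirling (a : ℕ → ℕ) (α : ℝ) (h : Tendsto (fun n : ℕ => (a n : ℝ) / n) atTop (nhds α)) :
    Tendsto (fun n : ℕ => (Real.log (a n).factorial - a n * Real.log n) / n) atTop
      (nhds (α * Real.log α - α)) := by
  have hα : 0 ≤ α := ge_of_tendsto' h (fun n => by positivity)
  have h1 : Tendsto (fun n : ℕ => ((a n : ℝ)/n) * Real.log ((a n : ℝ)/n) - (a n : ℝ)/n) atTop (nhds (α * Real.log α - α)) :=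
    ((Real.continuous_mul_log.tendsto α).comp h).sub h
  have h2 : Tendsto (fun n : ℕ => ((a n : ℝ)/n) * Real.log ((a n : ℝ)/n) - (a n : ℝ)/n + ((1 + Real.log (α+1)) * (1/(n:ℝ)) + Real.log n / n)) atTop (nhds (α * Real.log α - α)) := by
    have := h1.add ((tendsto_one_div_atTop_nhds_zero_nat (𝕜 := ℝ)).const_mul (1 + Real.log (α+1)) |>.add ldp_log_div)
    simpa using this
  have hid : ∀ n : ℕ, 0 < n → ((a n : ℝ)/n) * Real.log ((a n : ℝ)/n) - (a n : ℝ)/n = ((a n : ℝ) * Real.log (a n) - a n - a n * Real.log n)/n := by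
    intro n hn
    have hn' : (0:ℝ) < n := by exact_mod_cast hn
    rcases Nat.eq_zero_or_pos (a n) with h0 | h0
    · simp [h0]
    · have h0' : (0:ℝ) < a n := by exact_mod_cast h0
      rw [Real.log_div h0'.ne' hn'.ne']; field_simp; ring
  refine tendsto_of_tendsto_of_tendsto_of_le_of_le' h1 h2 ?_ ?_
  · filter_upwards [eventually_gt_atTop 0] with n hn
    rw [hid n hn]
    have := ldp_log_fact_lower (a n)
    gcongr
  · filter_upwards [eventually_gt_atTop 0, h.eventually_lt_const (lt_add_one α)] with n hn hlt
    have hn' : (0:ℝ) < n := by exact_mod_cast hn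
    rw [hid n hn]
    have h3 := ldp_log_fact_upper (a n)
    have hn1 : (1:ℝ) ≤ n := by exact_mod_cast hn
    have h4 : Real.log (a n) ≤ Real.log (α+1) + Real.log n := by
      rcases Nat.eq_zero_or_pos (a n) with h0 | h0
      · rw [h0]
        have := Real.log_nonneg (by linarith : (1:ℝ) ≤ α + 1)
        have := Real.log_nonneg hn1
        simp; linarith
      · have h0' : (0:ℝ) < a n := by exact_mod_cast h0
        rw [← Real.log_mul (by linarith) (by linarith)]
        apply Real.log_le_log h0'
        rw [div_lt_iff₀ hn'] at hlt
        exact hlt.le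
    have : ((a n : ℝ) * Real.log (a n) - a n - a n * Real.log n)/n + ((1 + Real.log (α+1)) * (1/(n:ℝ)) + Real.log n / n)
       = ((a n : ℝ) * Real.log (a n) - a n - a n * Real.log n + (1 + Real.log (α+1)) + Real.log n)/n := by
      field_simp
      ring
    rw [this]
    gcongr
    linarith

lemma ldp_exists_d {n L : ℕ} (N : ℕ → ℕ) (hN : ∑ k ∈ Finset.range (L+1), N k = n) :
    ∃ d : Fin n → Fin (L+1), ∀ k : Fin (L+1), (Finset.univ.filter (fun i => d i = k)).card = N k := by
  have e : Fin n ≃ (k : Fin (L+1)) × Fin (N k) := by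
    apply Fintype.equivOfCardEq
    simp [Fintype.card_sigma, ← hN, Finset.sum_range]
  refine ⟨fun i => (e i).1, fun k => ?_⟩
  rw [← Fintype.card_fin (N k), ← Finset.card_univ]
  symm
  apply Finset.card_bij (fun j _ => e.symm ⟨k, j⟩)
  · intro j _; simp
  · intro a _ b _ h
    simpa using h
  · intro i hi
    simp only [Finset.mem_filter, Finset.mem_univ, true_and] at hi
    subst hi
    exact ⟨(e i).2, by simp, by simp⟩

lemma ldp_d_sum {n L : ℕ} (N : ℕ → ℕ) (d : Fin n → Fin (L+1))
    (hd : ∀ k : Fin (L+1), (Finset.univ.filter (fun i => d i = k)).card = N k) :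
    ∑ i, (d i : ℕ) = ∑ k ∈ Finset.range (L+1), k * N k := by
  rw [← Finset.sum_fiberwise_of_maps_to (t := Finset.univ) (g := d) (by simp), Finset.sum_range]
  apply Finset.sum_congr rfl
  intro k _
  rw [← hd k, Finset.sum_congr rfl (g := fun _ => (k:ℕ))]
  · simp [mul_comm]
  · intro i hi
    simp only [Finset.mem_filter] at hi
    rw [hi.2]

lemma ldp_d_prod {n L : ℕ} (N : ℕ → ℕ) (d : Fin n → Fin (L+1))
    (hd : ∀ k : Fin (L+1), (Finset.univ.filter (fun i => d i = k)).card = N k) :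
    ∏ i, ((d i : ℕ).factorial : ℝ) = ∏ k ∈ Finset.range (L+1), (k.factorial : ℝ)^(N k) := by
  rw [← Finset.prod_fiberwise_of_maps_to (t := Finset.univ) (g := d) (by simp), Finset.prod_range]
  apply Finset.prod_congr rfl
  intro k _
  rw [← hd k, Finset.prod_congr rfl (g := fun _ => ((k:ℕ).factorial : ℝ))]
  · simp
  · intro i hi
    simp only [Finset.mem_filter] at hi
    rw [hi.2]

lemma ldp_d_card {n L : ℕ} (N : ℕ → ℕ) (d : Fin n → Fin (L+1))
    (hd : ∀ k : Fin (L+1), (Finset.univ.filter (fun i => d i = k)).card = N k) (k : ℕ) :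
    (Finset.univ.filter (fun i => (d i : ℕ) = k)).card = if k ≤ L then N k else 0 := by
  split_ifs with h
  · rw [← hd ⟨k, by omega⟩]
    congr 1; ext i; simp [Fin.ext_iff]
  · rw [Finset.card_eq_zero, Finset.filter_eq_empty_iff]
    intro i _
    have := (d i).2
    omega

/-- the class sizes -/
noncomputable def ldpN (P : ℕ → ℝ) (L n k : ℕ) : ℕ :=
  if k = 0 then n - ∑ j ∈ Finset.range L, ⌊(n:ℝ) * P (j+1)⌋₊ else ⌊(n:ℝ) * P k⌋₊

lemma ldp_floor_lim (t : ℝ) (ht : 0 ≤ t) : Tendsto (fun n : ℕ => (⌊(n:ℝ) * t⌋₊ : ℝ) / n) atTop (nhds t) := by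
  have := (tendsto_nat_floor_mul_div_atTop ht).comp (tendsto_natCast_atTop_atTop (R := ℝ))
  refine this.congr fun n => ?_
  simp [mul_comm]

lemma ldpN_le {P : ℕ → ℝ} {L : ℕ} (hP0 : ∀ k, 0 ≤ P k) (hsum : ∑ k ∈ Finset.range (L+1), P k = 1) (n : ℕ) :
    ∑ j ∈ Finset.range L, ⌊(n:ℝ) * P (j+1)⌋₊ ≤ n := by
  have : ((∑ j ∈ Finset.range L, ⌊(n:ℝ) * P (j+1)⌋₊ : ℕ) : ℝ) ≤ n := by
    push_cast
    calc _ ≤ ∑ j ∈ Finset.range L, (n:ℝ) * P (j+1) :=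
          Finset.sum_le_sum fun j _ => Nat.floor_le (mul_nonneg (Nat.cast_nonneg _) (hP0 _))
      _ = n * ∑ j ∈ Finset.range L, P (j+1) := by rw [Finset.mul_sum]
      _ ≤ n * 1 := by
        gcongr
        rw [Finset.sum_range_succ'] at hsum
        linarith [hP0 0]
      _ = n := mul_one _
  exact_mod_cast this

lemma ldpN_sum {P : ℕ → ℝ} {L : ℕ} (hP0 : ∀ k, 0 ≤ P k) (hsum : ∑ k ∈ Finset.range (L+1), P k = 1) (n : ℕ) :
    ∑ k ∈ Finset.range (L+1), ldpN P L n k = n := by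
  rw [Finset.sum_range_succ']
  have := ldpN_le hP0 hsum n
  simp [ldpN]
  omega

lemma ldpN_lim {P : ℕ → ℝ} {L : ℕ} (hP0 : ∀ k, 0 ≤ P k) (hsum : ∑ k ∈ Finset.range (L+1), P k = 1) (k : ℕ) :
    Tendsto (fun n : ℕ => (ldpN P L n k : ℝ) / n) atTop (nhds (P k)) := by
  by_cases hk : k = 0
  · subst hk
    have h1 : Tendsto (fun n : ℕ => 1 - ∑ j ∈ Finset.range L, (⌊(n:ℝ) * P (j+1)⌋₊ : ℝ) / n) atTop (nhds (1 - ∑ j ∈ Finset.range L, P (j+1))) :=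
      tendsto_const_nhds.sub (tendsto_finsetSum _ fun j _ => ldp_floor_lim _ (hP0 _))
    rw [Finset.sum_range_succ'] at hsum
    rw [show P 0 = 1 - ∑ j ∈ Finset.range L, P (j+1) by linarith]
    refine h1.congr' ?_
    filter_upwards [eventually_gt_atTop 0] with n hn
    have hn' : (0:ℝ) < n := by exact_mod_cast hn
    rw [← Finset.sum_range_succ' P] at hsum
    simp only [ldpN, if_true]
    rw [Nat.cast_sub (ldpN_le hP0 hsum n), sub_div, div_self hn'.ne', ← Finset.sum_div]
    push_cast
    rfl
  · simp only [ldpN, hk, if_false]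
    exact ldp_floor_lim _ (hP0 _)


lemma ldp_log_identity (n M r m' Lq L : ℕ) (N : ℕ → ℕ) (x : ℝ) (hx0 : 0 < x) (hx1 : x < 1) (hn : 0 < n)
   (hN : ∑ k ∈ Finset.range (L+1), N k = n) (hM : M = 2 * m' + Lq) :
   Real.log ((n.factorial : ℝ) * M.factorial * (x^r * (1-x)^n) /
      ((n : ℝ)^(2*m') * Lq.factorial * (∏ k ∈ Finset.range (L+1), (k.factorial : ℝ)^(N k)) *
       (∏ k ∈ Finset.range (L+1), ((N k).factorial : ℝ)))) / n =
   (Real.log n.factorial - n * Real.log n) / n + (Real.log M.factorial - M * Real.log n)/n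
     + ((r : ℝ) / n) * Real.log x + Real.log (1-x)
     - (Real.log Lq.factorial - Lq * Real.log n)/n
     - ∑ k ∈ Finset.range (L+1), ((N k : ℝ)/n) * Real.log k.factorial
     - ∑ k ∈ Finset.range (L+1), (Real.log (N k).factorial - N k * Real.log n)/n := by
  have hn' : (0:ℝ) < n := by exact_mod_cast hn
  have hx : 0 < 1 - x := by linarith
  have hQ : (0:ℝ) < ∏ k ∈ Finset.range (L+1), ((N k).factorial : ℝ) := Finset.prod_pos fun k _ => by positivity
  have hW : (0:ℝ) < ∏ k ∈ Finset.range (L+1), (k.factorial : ℝ)^(N k) := Finset.prod_pos fun k _ => by positivity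
  rw [Real.log_div (by positivity) (by positivity), Real.log_mul (by positivity) (by positivity),
    Real.log_mul (by positivity) (by positivity), Real.log_mul (by positivity) (by positivity),
    Real.log_mul (by positivity) (by positivity), Real.log_mul (by positivity) (by positivity),
    Real.log_mul (by positivity) (by positivity), Real.log_prod (fun k _ => by positivity),
    Real.log_prod (fun k _ => by positivity), Real.log_pow, Real.log_pow, Real.log_pow]
  simp only [Real.log_pow]
  have hN' : ∑ k ∈ Finset.range (L+1), (N k : ℝ) = n := by exact_mod_cast hN
  have hM' : (M:ℝ) = 2 * m' + Lq := by exact_mod_cast hM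
  have e1 : ∑ k ∈ Finset.range (L+1), ((N k : ℝ)/n) * Real.log k.factorial = (∑ k ∈ Finset.range (L+1), (N k : ℝ) * Real.log k.factorial) / n := by
    rw [Finset.sum_div]; apply Finset.sum_congr rfl; intro k _; ring
  have e2 : ∑ k ∈ Finset.range (L+1), (Real.log (N k).factorial - N k * Real.log n)/n =
      (∑ k ∈ Finset.range (L+1), Real.log (N k).factorial - n * Real.log n) / n := by
    rw [← Finset.sum_div, Finset.sum_sub_distrib, ← Finset.sum_mul, hN']
  rw [e1, e2, hM']
  push_cast
  field_simp
  ring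

lemma ldp_asym (L : ℕ) (P : ℕ → ℝ) (c a τ η : ℝ) (hP0 : ∀ k, 0 ≤ P k) (hPL : ∀ k, L < k → P k = 0)
    (hsum : ∑ k ∈ Finset.range (L+1), P k = 1) (ha : ∑ k ∈ Finset.range (L+1), (k:ℝ) * P k = a)
    (hac : a ≤ c) (hτ0 : 0 < τ) (hτa : τ < a) (hτ1 : τ < 1) (hη : 0 < η) :
    ∀ᶠ n : ℕ in atTop, ∀ A : Set (SimpleGraph (Fin n)),
      (∀ z, (∀ k, |degreeDist z k - P k| ≤ c - a + 2 * τ + η) → z ∈ A) →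
      ENNReal.ofReal (Real.exp (n * ((a * Real.log a - a + τ + Real.log (1 - τ) -
        ∑ k ∈ Finset.range (L+1), (P k * Real.log k.factorial + P k * Real.log (P k))) - η))) ≤
      erProb n ⌊(n:ℝ) * c / 2⌋₊ A := by
  have hc : 0 < c := by linarith
  set S : ℕ → ℕ := fun n => ∑ k ∈ Finset.range (L+1), k * ldpN P L n k with hS
  set t : ℕ → ℕ := fun n => ⌊(n:ℝ) * τ⌋₊ with ht
  set m' : ℕ → ℕ := fun n => (S n - t n) / 2 with hm'
  set r : ℕ → ℕ := fun n => S n - 2 * m' n with hr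
  set m : ℕ → ℕ := fun n => ⌊(n:ℝ) * c / 2⌋₊ with hm
  have lN := ldpN_lim hP0 hsum
  have lS : Tendsto (fun n => (S n : ℝ) / n) atTop (nhds a) := by
    rw [← ha]
    have : Tendsto (fun n : ℕ => ∑ k ∈ Finset.range (L+1), (k:ℝ) * ((ldpN P L n k : ℝ) / n)) atTop (nhds (∑ k ∈ Finset.range (L+1), (k:ℝ) * P k)) :=
      tendsto_finsetSum _ fun k _ => (lN k).const_mul _
    refine this.congr fun n => ?_
    simp only [hS]; push_cast; rw [Finset.sum_div]
    apply Finset.sum_congr rfl; intro k _; ring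
  have lt' : Tendsto (fun n => (t n : ℝ) / n) atTop (nhds τ) := ldp_floor_lim τ hτ0.le
  have l1 : Tendsto (fun n : ℕ => 1 / (n:ℝ)) atTop (nhds 0) := tendsto_one_div_atTop_nhds_zero_nat
  have htS : ∀ᶠ n in atTop, t n ≤ S n := by
    have := lt'.eventually_lt lS hτa
    filter_upwards [this, eventually_gt_atTop 0] with n h hn
    have hn' : (0:ℝ) < n := by exact_mod_cast hn
    rw [div_lt_div_iff_of_pos_right hn'] at h
    exact_mod_cast h.le
  have hrt : ∀ᶠ n in atTop, t n ≤ r n ∧ r n ≤ t n + 1 := by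
    filter_upwards [htS] with n h
    simp only [hr, hm']; omega
  have lr : Tendsto (fun n => (r n : ℝ) / n) atTop (nhds τ) := by
    have u : Tendsto (fun n => (t n : ℝ) / n + 1 / n) atTop (nhds τ) := by simpa using lt'.add l1
    refine tendsto_of_tendsto_of_tendsto_of_le_of_le' lt' u ?_ ?_
    · filter_upwards [hrt] with n h
      have := h.1
      gcongr
    · filter_upwards [hrt] with n h
      rw [← add_div]
      have : (r n : ℝ) ≤ t n + 1 := by exact_mod_cast h.2
      gcongr
  have hrL : ∀ᶠ n in atTop, L^2 ≤ r n := by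
    have e : Tendsto (fun n : ℕ => ((L:ℝ)^2) * (1 / (n:ℝ))) atTop (nhds 0) := by simpa using l1.const_mul ((L:ℝ)^2)
    filter_upwards [e.eventually_lt lr hτ0, eventually_gt_atTop 0] with n h hn
    have hn' : (0:ℝ) < n := by exact_mod_cast hn
    rw [mul_one_div, div_lt_div_iff_of_pos_right hn'] at h
    exact_mod_cast h.le
  have hSr : ∀ n, S n = 2 * m' n + r n := by
    intro n; simp only [hr, hm']; omega
  have lsub : ∀ (b : ℕ → ℕ) (β : ℝ), Tendsto (fun n => (b n : ℝ)/n) atTop (nhds β) → (∀ᶠ n in atTop, L^2 ≤ b n) →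
      Tendsto (fun n => ((b n - L^2 : ℕ) : ℝ)/n) atTop (nhds β) := by
    intro b β hb hL
    have e : Tendsto (fun n : ℕ => (b n : ℝ)/n - ((L:ℝ)^2) * (1 / (n:ℝ))) atTop (nhds β) := by
      simpa using hb.sub (l1.const_mul ((L:ℝ)^2))
    refine e.congr' ?_
    filter_upwards [hL] with n h
    rw [Nat.cast_sub h, sub_div]; push_cast; ring
  have lrL := lsub r τ lr hrL
  have lSL := lsub S a lS (by filter_upwards [hrL] with n h; rw [hSr]; omega)
  have hSc : ∀ n, (S n : ℝ) ≤ n * c := by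
    intro n
    calc (S n : ℝ) = ∑ k ∈ Finset.range (L+1), (k:ℝ) * ldpN P L n k := by simp only [hS]; push_cast; rfl
      _ ≤ ∑ k ∈ Finset.range (L+1), (n:ℝ) * ((k:ℝ) * P k) := by
        apply Finset.sum_le_sum
        intro k _
        by_cases hk : k = 0
        · simp [hk]
        · have : (ldpN P L n k : ℝ) ≤ n * P k := by
            simp only [ldpN, hk, if_false]
            exact Nat.floor_le (mul_nonneg (Nat.cast_nonneg _) (hP0 _))
          calc _ ≤ (k:ℝ) * (n * P k) := by gcongr
            _ = _ := by ring
      _ = n * a := by rw [← Finset.mul_sum, ha]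
      _ ≤ n * c := by gcongr
  have hmm : ∀ n, m' n ≤ m n := by
    intro n
    apply Nat.le_floor
    have h1 : (S n : ℝ) = 2 * m' n + r n := by exact_mod_cast hSr n
    have h2 := hSc n
    have h3 : (0:ℝ) ≤ r n := Nat.cast_nonneg _
    linarith
  have hmc : ∀ᶠ n in atTop, m n ≤ n.choose 2 := by
    filter_upwards [eventually_ge_atTop (⌈c⌉₊ + 1)] with n hn
    have h1 : c + 1 ≤ n := by
      have : ((⌈c⌉₊ + 1 : ℕ) : ℝ) ≤ n := by exact_mod_cast hn
      push_cast at this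
      linarith [Nat.le_ceil c]
    have : (m n : ℝ) ≤ (n.choose 2 : ℕ) := by
      rw [Nat.cast_choose_two]
      refine (Nat.floor_le (by positivity)).trans ?_
      have : c ≤ (n:ℝ) - 1 := by linarith
      gcongr
    exact_mod_cast this
  -- distance limit
  have lm : Tendsto (fun n => (m n : ℝ)/n) atTop (nhds (c/2)) := by
    have := ldp_floor_lim (c/2) (by positivity)
    refine this.congr fun n => ?_
    simp only [hm, mul_div_assoc]
  have lm' : Tendsto (fun n => (m' n : ℝ)/n) atTop (nhds ((a - τ)/2)) := by
    refine ((lS.sub lr).div_const 2).congr fun n => ?_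
    have h1 : (S n : ℝ) = 2 * m' n + r n := by exact_mod_cast hSr n
    rw [h1]; ring
  have ldist : Tendsto (fun n => (2 * ((m n : ℝ) - m' n) + r n)/n) atTop (nhds (c - a + 2 * τ)) := by
    have := (((lm.sub lm').const_mul 2).add lr)
    rw [show 2 * (c/2 - (a-τ)/2) + τ = c - a + 2 * τ by ring] at this
    refine this.congr fun n => ?_
    ring
  have hdist := ldist.eventually_lt_const (show c - a + 2 * τ < c - a + 2 * τ + η/2 by linarith)
  have hNclose : ∀ᶠ n in atTop, ∀ k ∈ Finset.range (L+1), |(ldpN P L n k : ℝ)/n - P k| < η/2 := by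
    rw [Filter.eventually_all_finset]
    intro k _
    have := Metric.tendsto_nhds.1 (lN k) (η/2) (by linarith)
    simpa [Real.dist_eq] using this
  -- log limit
  set J := a * Real.log a - a + τ + Real.log (1 - τ) -
        ∑ k ∈ Finset.range (L+1), (P k * Real.log k.factorial + P k * Real.log (P k)) with hJ
  have llog : Tendsto (fun n : ℕ => (Real.log n.factorial - n * Real.log n) / n + (Real.log (S n - L^2).factorial - (S n - L^2 : ℕ) * Real.log n)/n
     + ((r n : ℝ) / n) * Real.log τ + Real.log (1-τ)
     - (Real.log (r n - L^2).factorial - (r n - L^2 : ℕ) * Real.log n)/n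
     - ∑ k ∈ Finset.range (L+1), ((ldpN P L n k : ℝ)/n) * Real.log k.factorial
     - ∑ k ∈ Finset.range (L+1), (Real.log (ldpN P L n k).factorial - ldpN P L n k * Real.log n)/n) atTop (nhds J) := by
    have s1 := ldp_stirling (fun n => n) 1 (by
      refine tendsto_const_nhds.congr' ?_
      filter_upwards [eventually_gt_atTop 0] with n hn
      have hn' : (0:ℝ) < n := by exact_mod_cast hn
      rw [div_self hn'.ne'])
    have s2 := ldp_stirling (fun n => S n - L^2) a lSL
    have s3 := ldp_stirling (fun n => r n - L^2) τ lrL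
    have s4 : Tendsto (fun n : ℕ => ∑ k ∈ Finset.range (L+1), ((ldpN P L n k : ℝ)/n) * Real.log k.factorial) atTop
        (nhds (∑ k ∈ Finset.range (L+1), P k * Real.log k.factorial)) :=
      tendsto_finsetSum _ fun k _ => (lN k).mul_const _
    have s5 : Tendsto (fun n : ℕ => ∑ k ∈ Finset.range (L+1), (Real.log (ldpN P L n k).factorial - ldpN P L n k * Real.log n)/n) atTop
        (nhds (∑ k ∈ Finset.range (L+1), (P k * Real.log (P k) - P k))) :=
      tendsto_finsetSum _ fun k _ => ldp_stirling _ _ (lN k)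
    have s := ((((s1.add s2).add (lr.mul_const (Real.log τ))).add_const (Real.log (1-τ))).sub s3).sub s4 |>.sub s5
    convert s using 2
    rw [hJ, Finset.sum_add_distrib, Finset.sum_sub_distrib, hsum, Real.log_one]
    ring
  have hJl := llog.eventually_const_lt (show J - η < J by linarith)
  filter_upwards [hJl, hNclose, hdist, hmc, hrL, eventually_gt_atTop 0] with n h1 h2 h3 h4 h5 hn A hA
  have hn' : (0:ℝ) < n := by exact_mod_cast hn
  have hNs := ldpN_sum hP0 hsum n
  obtain ⟨d, hd⟩ := ldp_exists_d (ldpN P L n) hNs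
  have hdS : ∑ i, (d i : ℕ) = 2 * m' n + r n := by rw [← hSr n]; exact ldp_d_sum _ d hd
  refine le_trans ?_ (ldp_prob hn d τ hτ0 hτ1 (hmm n) h4 hdS h5 A ?_)
  · apply ENNReal.ofReal_le_ofReal
    rw [ldp_d_prod _ d hd, ← hSr n]
    simp only [hd]
    rw [← Finset.prod_range (fun k => ((ldpN P L n k).factorial : ℝ))]
    have hid := ldp_log_identity n (S n - L^2) (r n) (m' n) (r n - L^2) L (ldpN P L n) τ hτ0 hτ1 hn hNs (by rw [hSr n]; omega)
    rw [← hid] at h1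
    have hx : 0 < 1 - τ := by linarith
    have hQ : (0:ℝ) < ∏ k ∈ Finset.range (L+1), ((ldpN P L n k).factorial : ℝ) := Finset.prod_pos fun k _ => by positivity
    have hW : (0:ℝ) < ∏ k ∈ Finset.range (L+1), (k.factorial : ℝ)^(ldpN P L n k) := Finset.prod_pos fun k _ => by positivity
    rw [lt_div_iff₀ hn'] at h1
    rw [← Real.le_log_iff_exp_le (by positivity)]
    linarith
  · intro z hz
    apply hA z
    intro k
    have h6 := hz k
    rw [ldp_d_card _ d hd] at h6
    have h7 : |(((if k ≤ L then ldpN P L n k else 0 : ℕ) : ℝ))/n - P k| ≤ η/2 := by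
      split_ifs with hk
      · exact (h2 k (Finset.mem_range.2 (by omega))).le
      · rw [hPL k (by omega)]; simp; linarith
    have h8 := abs_sub_le (degreeDist z k) ((((if k ≤ L then ldpN P L n k else 0 : ℕ) : ℝ))/n) (P k)
    linarith


lemma ldp_term_nonneg {p q : ℝ} (hp : 0 ≤ p) (hq : 0 < q) : 0 ≤ p * Real.log (p / q) - p + q := by
  rcases hp.eq_or_lt with rfl | hp
  · simp [hq.le]
  · have h := Real.log_le_sub_one_of_pos (show 0 < q / p by positivity)
    rw [Real.log_div hq.ne' hp.ne'] at h
    rw [Real.log_div hp.ne' hq.ne']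
    have := mul_le_mul_of_nonneg_left h hp.le
    have e : p * (q / p - 1) = q - p := by field_simp
    rw [e] at this
    linarith

lemma ldp_entropy (c : ℝ) (hc : 0 < c) (p : ℕ → ℝ) (hp : IsPMF p) (hm : HasSum (fun k : ℕ => (k : ℝ) * p k) c)
    (hfin : relEntropy p (poissonPMF c) ≠ ∞) :
    HasSum (fun k : ℕ => p k * Real.log k.factorial + p k * Real.log (p k))
      ((relEntropy p (poissonPMF c)).toReal - c + c * Real.log c) := by
  have hq : ∀ k, 0 < poissonPMF c k := fun k => by unfold poissonPMF; positivity
  have hrel : relEntropy p (poissonPMF c) = ∑' k, ENNReal.ofReal (p k * Real.log (p k / poissonPMF c k) - p k + poissonPMF c k) := by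
    unfold relEntropy
    rw [if_pos]
    intro k hk
    exact absurd hk (hq k).ne'
  have hnn := fun k => ldp_term_nonneg (hp.1 k) (hq k)
  have hf : HasSum (fun k => p k * Real.log (p k / poissonPMF c k) - p k + poissonPMF c k) (relEntropy p (poissonPMF c)).toReal := by
    rw [hrel] at hfin ⊢
    have h1 := ENNReal.summable_toReal hfin
    have h2 := h1.hasSum
    rw [← ENNReal.tsum_toReal_eq (fun k => ENNReal.ofReal_ne_top)] at h2
    simpa only [ENNReal.toReal_ofReal (hnn _)] using h2
  have hqs : HasSum (poissonPMF c) 1 := by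
    have := ProbabilityTheory.hasSum_one_poissonMeasure ⟨c, hc.le⟩
    exact this
  have key := (((hf.sub (hp.2.mul_left c)).add (hm.mul_left (Real.log c))).add hp.2).sub hqs
  convert key using 1
  · rfl
  · funext k
    rcases (hp.1 k).eq_or_lt with h | h
    · simp [← h]
    · have hk : (0:ℝ) < k.factorial := by positivity
      have hl : Real.log (p k / poissonPMF c k) = Real.log (p k) + c - k * Real.log c + Real.log k.factorial := by
        rw [Real.log_div h.ne' (hq k).ne']
        unfold poissonPMF
        rw [Real.log_div (by positivity) hk.ne', Real.log_mul (by positivity) (by positivity), Real.log_exp, Real.log_pow]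
        ring
      rw [hl]; ring
  · ring

noncomputable def ldpP (p : ℕ → ℝ) (L k : ℕ) : ℝ :=
  if k = 0 then 1 - ∑ j ∈ Finset.range L, p (j+1) else if k ≤ L then p k else 0

lemma ldpP_sum (p : ℕ → ℝ) (L : ℕ) (F : ℕ → ℝ → ℝ) :
    ∑ k ∈ Finset.range (L+1), F k (ldpP p L k) =
      ∑ k ∈ Finset.range (L+1), F k (p k) + (F 0 (ldpP p L 0) - F 0 (p 0)) := by
  rw [Finset.sum_range_succ', Finset.sum_range_succ']
  have : ∑ k ∈ Finset.range L, F (k+1) (ldpP p L (k+1)) = ∑ k ∈ Finset.range L, F (k+1) (p (k+1)) := by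
    refine Finset.sum_congr rfl fun k hk => ?_
    have hk' : k + 1 ≤ L := by have := Finset.mem_range.1 hk; omega
    simp [ldpP, hk']
  rw [this]; ring

lemma ldpP_zero (p : ℕ → ℝ) (L : ℕ) : ldpP p L 0 = p 0 + (1 - ∑ j ∈ Finset.range (L+1), p j) := by
  rw [Finset.sum_range_succ']; simp only [ldpP, if_true]; ring

lemma ldpP_tendsto (p : ℕ → ℝ) (hp : IsPMF p) (k : ℕ) : Tendsto (fun L => ldpP p L k) atTop (nhds (p k)) := by
  rcases Nat.eq_zero_or_pos k with rfl | hk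
  · simp_rw [ldpP_zero]
    have := (hp.2.tendsto_sum_nat.comp (tendsto_add_atTop_nat 1))
    have h2 := (this.const_sub 1).const_add (p 0)
    simpa using h2
  · refine tendsto_const_nhds.congr' ?_
    filter_upwards [eventually_ge_atTop k] with L hL
    simp [ldpP, hk.ne', hL]

lemma ldp_point (c : ℝ) (hc : 0 < c) (p : ℕ → ℝ) (hp : IsPMF p) (hm : HasSum (fun k : ℕ => (k : ℝ) * p k) c)
    (hfin : relEntropy p (poissonPMF c) ≠ ∞) (I : Finset ℕ) (δ ε : ℝ) (hδ : 0 < δ) (hε : 0 < ε) :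
    ∀ᶠ n : ℕ in atTop, ∀ A : Set (SimpleGraph (Fin n)),
      (∀ z, (∀ k ∈ I, |degreeDist z k - p k| < δ) → z ∈ A) →
      ENNReal.ofReal (Real.exp (n * (-(relEntropy p (poissonPMF c)).toReal - ε))) ≤
      erProb n ⌊(n:ℝ) * c / 2⌋₊ A := by
  set h := (relEntropy p (poissonPMF c)).toReal with hh
  have hg := ldp_entropy c hc p hp hm hfin
  rw [← hh] at hg
  have hgt := hg.tendsto_sum_nat.comp (tendsto_add_atTop_nat 1)
  have hat := hm.tendsto_sum_nat.comp (tendsto_add_atTop_nat 1)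
  set a : ℕ → ℝ := fun L => ∑ k ∈ Finset.range (L+1), (k:ℝ) * p k with hadef
  have hat' : Tendsto a atTop (nhds c) := hat
  have h0 := ldpP_tendsto p hp 0
  have hS : Tendsto (fun L => ∑ k ∈ Finset.range (L+1),
      (ldpP p L k * Real.log k.factorial + ldpP p L k * Real.log (ldpP p L k))) atTop
      (nhds (h - c + c * Real.log c)) := by
    have e : ∀ L, ∑ k ∈ Finset.range (L+1),
      (ldpP p L k * Real.log k.factorial + ldpP p L k * Real.log (ldpP p L k)) =
      ∑ k ∈ Finset.range (L+1), (p k * Real.log k.factorial + p k * Real.log (p k)) +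
       (ldpP p L 0 * Real.log (ldpP p L 0) - p 0 * Real.log (p 0)) := by
      intro L
      rw [ldpP_sum p L (fun k x => x * Real.log k.factorial + x * Real.log x)]
      simp
    simp_rw [e]
    have h1 := (Real.continuous_mul_log.tendsto (p 0)).comp h0
    have h2 := hgt.add (h1.sub_const (p 0 * Real.log (p 0)))
    simpa using h2
  have hJ : Tendsto (fun L => a L * Real.log (a L) - a L - ∑ k ∈ Finset.range (L+1),
      (ldpP p L k * Real.log k.factorial + ldpP p L k * Real.log (ldpP p L k))) atTop (nhds (-h)) := by
    have h1 := (((Real.continuous_mul_log.tendsto c).comp hat').sub hat').sub hS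
    have e : c * Real.log c - c - (h - c + c * Real.log c) = -h := by ring
    rw [e] at h1
    exact h1
  have hI : ∀ᶠ L in atTop, ∀ k ∈ I, |ldpP p L k - p k| < δ / 4 := by
    rw [Filter.eventually_all_finset]
    intro k _
    have := Metric.tendsto_nhds.1 (ldpP_tendsto p hp k) (δ/4) (by positivity)
    simpa [Real.dist_eq] using this
  have hE1 := hat'.eventually (lt_mem_nhds (show c - δ/4 < c by linarith))
  have hE2 := hat'.eventually (lt_mem_nhds hc)
  have hE3 := hJ.eventually (lt_mem_nhds (show -h - ε/3 < -h by linarith))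
  obtain ⟨L, hL1, hL2, hL3, hL4⟩ := (hI.and (hE1.and (hE2.and hE3))).exists
  have hac : a L ≤ c := sum_le_hasSum _ (fun k _ => mul_nonneg (Nat.cast_nonneg _) (hp.1 k)) hm
  have hτ : ∃ τ : ℝ, 0 < τ ∧ τ < a L ∧ τ < 1 ∧ 2 * τ < δ / 4 ∧ -(ε/3) < τ + Real.log (1 - τ) := by
    have hc0 : ContinuousAt (fun τ : ℝ => τ + Real.log (1 - τ)) 0 := by
      refine continuousAt_id.add (ContinuousAt.log (by fun_prop) (by norm_num))
    have h1 : ∀ᶠ τ : ℝ in nhds 0, -(ε/3) < τ + Real.log (1 - τ) :=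
      hc0.eventually (lt_mem_nhds (by simp; linarith))
    have h2 : ∀ᶠ τ : ℝ in nhds 0, τ < min (a L) (min 1 (δ/8)) := gt_mem_nhds (by positivity)
    obtain ⟨τ, ⟨h3, h4⟩, h5⟩ := (((h1.and h2).filter_mono nhdsWithin_le_nhds).and
      (self_mem_nhdsWithin : ∀ᶠ τ : ℝ in nhdsWithin 0 (Set.Ioi 0), τ ∈ Set.Ioi 0)).exists
    simp only [lt_min_iff] at h4
    exact ⟨τ, h5, h4.1, h4.2.1, by linarith [h4.2.2], h3⟩
  obtain ⟨τ, t0, ta, t1, td, te⟩ := hτ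
  have hη : 0 < min (ε/3) (δ/8) := by positivity
  have hηe := min_le_left (ε/3) (δ/8)
  have hηd := min_le_right (ε/3) (δ/8)
  set η := min (ε/3) (δ/8)
  have hsum1 : ∑ j ∈ Finset.range (L+1), p j ≤ 1 := sum_le_hasSum _ (fun k _ => hp.1 k) hp.2
  have hP0 : ∀ k, 0 ≤ ldpP p L k := by
    intro k
    rcases Nat.eq_zero_or_pos k with rfl | hk
    · rw [ldpP_zero]; linarith [hp.1 0]
    · simp only [ldpP, hk.ne', if_false]
      split_ifs
      · exact hp.1 k
      · exact le_rfl
  have hPL : ∀ k, L < k → ldpP p L k = 0 := by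
    intro k hk
    have h1 : k ≠ 0 := by omega
    simp [ldpP, h1, hk]
  have hPs : ∑ k ∈ Finset.range (L+1), ldpP p L k = 1 := by
    rw [ldpP_sum p L (fun _ x => x), ldpP_zero]; ring
  have hPa : ∑ k ∈ Finset.range (L+1), (k:ℝ) * ldpP p L k = a L := by
    rw [ldpP_sum p L (fun k x => (k:ℝ) * x)]; simp [hadef]
  filter_upwards [ldp_asym L (ldpP p L) c (a L) τ η hP0 hPL hPs hPa hac t0 ta t1 hη] with n hn A hA
  refine le_trans (ENNReal.ofReal_le_ofReal (Real.exp_le_exp.2 ?_)) (hn A ?_)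
  · refine mul_le_mul_of_nonneg_left ?_ (Nat.cast_nonneg _)
    linarith
  · intro z hz
    refine hA z fun k hk => ?_
    have h1 := hz k
    have h2 := hL1 k hk
    rw [abs_le] at h1
    rw [abs_lt] at h2 ⊢
    constructor <;> linarith [h1.1, h1.2, h2.1, h2.2]

/-- **Large deviation lower bound** for the degree distribution of the classical
Erdős–Rényi graph `G(n, ⌊nc/2⌋)` with a fixed number of edges: for every set `Γ`
of measures on `ℕ` (with `int(Γ)` its interior in the weak = pointwise topology),
`liminf (1/n) log G(n,⌊nc/2⌋){D_z ∈ Γ} ≥ -inf_{p ∈ int(Γ)} I_c(p)`. -/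
theorem er_ldp_lower_bound (c : ℝ) (hc : 0 < c) (Γ : Set (ℕ → ℝ)) :
    liminf (fun n : ℕ => ((n : ℝ)⁻¹ : EReal) *
        ENNReal.log (erProb n ⌊(n : ℝ) * c / 2⌋₊ {z | degreeDist z ∈ Γ})) atTop
      ≥ -(⨅ p ∈ interior Γ, (rateI c p : EReal)) := by
  rw [ge_iff_le, EReal.neg_le]
  refine le_iInf₂ fun p hpΓ => ?_
  rw [EReal.neg_le]
  by_cases htop : rateI c p = ∞
  · rw [htop]; simp
  have hcond : IsPMF p ∧ HasSum (fun k : ℕ => (k : ℝ) * p k) c := by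
    by_contra hcon
    exact htop (by unfold rateI; rw [if_neg hcon])
  have hr : rateI c p = relEntropy p (poissonPMF c) := by unfold rateI; rw [if_pos hcond]
  rw [hr] at htop ⊢
  obtain ⟨I, u, hu, hsub⟩ := isOpen_pi_iff.1 (isOpen_interior (s := Γ)) p hpΓ
  have hδ : ∃ δ : ℝ, 0 < δ ∧ ∀ k ∈ I, Metric.ball (p k) δ ⊆ u k := by
    have hev : ∀ᶠ δ : ℝ in nhdsWithin 0 (Set.Ioi 0), ∀ k ∈ I, Metric.ball (p k) δ ⊆ u k := by
      rw [Filter.eventually_all_finset]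
      intro k hk
      obtain ⟨d, hd, hd2⟩ := Metric.isOpen_iff.1 (hu k hk).1 (p k) (hu k hk).2
      filter_upwards [Ioo_mem_nhdsGT hd] with x hx
      exact (Metric.ball_subset_ball hx.2.le).trans hd2
    obtain ⟨δ, h1, h2⟩ := (hev.and (self_mem_nhdsWithin : ∀ᶠ τ : ℝ in nhdsWithin 0 (Set.Ioi 0), τ ∈ Set.Ioi 0)).exists
    exact ⟨δ, h2, h1⟩
  obtain ⟨δ, hδ, hball⟩ := hδ
  rw [← EReal.ge_of_forall_gt_iff_ge]
  intro x hx
  have hcoe : ((relEntropy p (poissonPMF c) : ℝ≥0∞) : EReal) = (((relEntropy p (poissonPMF c)).toReal : ℝ) : EReal) :=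
    by
    rw [← EReal.toReal_coe_ennreal, EReal.coe_toReal] <;> simp [htop]
  rw [hcoe, ← EReal.coe_neg, EReal.coe_lt_coe_iff] at hx
  have hmain := ldp_point c hc p hcond.1 hcond.2 htop I δ (-(relEntropy p (poissonPMF c)).toReal - x) hδ (by linarith)
  refine le_liminf_of_le (by isBoundedDefault) ?_
  filter_upwards [hmain, eventually_gt_atTop 0] with n hn hn0
  have h1 := hn {z | degreeDist z ∈ Γ} (by
    intro z hz
    show degreeDist z ∈ Γ
    refine interior_subset (hsub ?_)
    intro k hk
    refine hball k hk ?_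
    rw [Metric.mem_ball, Real.dist_eq]
    exact hz k hk)
  have h2 := ENNReal.log_le_log h1
  rw [ENNReal.log_ofReal_of_pos (Real.exp_pos _), Real.log_exp] at h2
  have hn' : (0:ℝ) < n := by exact_mod_cast hn0
  have h3 : (0:EReal) ≤ ((n : ℝ)⁻¹ : EReal) := by
    rw [← EReal.coe_inv]; exact_mod_cast (inv_pos.2 hn').le
  refine le_trans (le_of_eq ?_) (mul_le_mul_of_nonneg_left h2 h3)
  rw [← EReal.coe_inv, ← EReal.coe_mul]
  congr 1
  field_simp
  ring
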